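/- Let Ξ be an m × m real symmetric positive definite matrix, u ∈ ℝᵐ with u ≠ 0, let C > uᵀ Ξ⁻¹ u, and let 0 < ε < 1. Define γ̄(η) = (1−ε) · (ηᵀ Ξ η) / ( ηᵀ Ξ η − 2 uᵀ η + C ) for η ∈ ℝᵐ. Then the denominator ηᵀΞη − 2uᵀη + C is strictly positive for every η ∈ ℝᵐ, and γ̄ attains its maximum over ℝᵐ at η* = C · Ξ⁻¹ u / ( uᵀ Ξ⁻¹ u ), with maximum value γ̄(η*) = (1−ε) · C / ( C − uᵀ Ξ⁻¹ u ). -/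

import Mathlib

open Matrix

/-- For a real symmetric positive definite `Ξ`, `u ≠ 0`, `C > uᵀΞ⁻¹u` and
`0 < ε < 1`, the average effective SNR `γ̄(η) = (1−ε)(ηᵀΞη)/(ηᵀΞη − 2uᵀη + C)` has everywhere
strictly positive denominator and attains its maximum over `ℝᵐ` at `η* = C·Ξ⁻¹u/(uᵀΞ⁻¹u)`,
with maximum value `(1−ε)·C/(C − uᵀΞ⁻¹u)`. -/
theorem aesnr_maximization
    (m : ℕ) (Ξ : Matrix (Fin m) (Fin m) ℝ) (hΞ : Ξ.PosDef)
    (u : Fin m → ℝ) (hu : u ≠ 0) (C ε : ℝ)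
    (hC : u ⬝ᵥ Ξ⁻¹.mulVec u < C) (hε0 : 0 < ε) (hε1 : ε < 1)
    (γ : (Fin m → ℝ) → ℝ)
    (hγ : ∀ η : Fin m → ℝ,
      γ η = (1 - ε) * (η ⬝ᵥ Ξ.mulVec η) / (η ⬝ᵥ Ξ.mulVec η - 2 * (u ⬝ᵥ η) + C))
    (ηStar : Fin m → ℝ)
    (hηStar : ηStar = (C / (u ⬝ᵥ Ξ⁻¹.mulVec u)) • Ξ⁻¹.mulVec u) :
    (∀ η : Fin m → ℝ, 0 < η ⬝ᵥ Ξ.mulVec η - 2 * (u ⬝ᵥ η) + C) ∧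
    (∀ η : Fin m → ℝ, γ η ≤ γ ηStar) ∧
    (γ ηStar = (1 - ε) * C / (C - u ⬝ᵥ Ξ⁻¹.mulVec u)) := by
  have hdet : IsUnit Ξ.det := (Matrix.isUnit_iff_isUnit_det _).1 hΞ.isUnit
  obtain ⟨w, hw⟩ : ∃ w, w = Ξ⁻¹.mulVec u := ⟨_, rfl⟩
  have hΞw : Ξ.mulVec w = u := by
    rw [hw, Matrix.mulVec_mulVec, Matrix.mul_nonsing_inv _ hdet, Matrix.one_mulVec]
  have hsymm : Ξᵀ = Ξ := by
    have := hΞ.isHermitian.eq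
    rwa [Matrix.conjTranspose_eq_transpose_of_trivial] at this
  rw [← hw] at hC hηStar ⊢
  have hw0 : w ≠ 0 := by
    rintro rfl
    exact hu (by rw [← hΞw, Matrix.mulVec_zero])
  have hs : 0 < u ⬝ᵥ w := by
    have := hΞ.dotProduct_mulVec_pos hw0
    rw [hΞw, star_trivial, dotProduct_comm] at this
    exact this
  have hwη : ∀ η : Fin m → ℝ, w ⬝ᵥ Ξ.mulVec η = u ⬝ᵥ η := by
    intro η
    rw [Matrix.dotProduct_mulVec, ← Matrix.mulVec_transpose, hsymm, hΞw]
  have key : ∀ (η : Fin m → ℝ) (t : ℝ),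
      0 ≤ η ⬝ᵥ Ξ.mulVec η - 2 * t * (u ⬝ᵥ η) + t ^ 2 * (u ⬝ᵥ w) := by
    intro η t
    have h := hΞ.posSemidef.dotProduct_mulVec_nonneg (η - t • w)
    rw [star_trivial, Matrix.mulVec_sub, Matrix.mulVec_smul, hΞw, sub_dotProduct,
      dotProduct_sub, dotProduct_sub, smul_dotProduct, smul_dotProduct, dotProduct_smul,
      dotProduct_smul, hwη, dotProduct_comm η u, dotProduct_comm w u] at h
    simp only [smul_eq_mul] at h
    linarith
  have hden : ∀ η : Fin m → ℝ, 0 < η ⬝ᵥ Ξ.mulVec η - 2 * (u ⬝ᵥ η) + C := by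
    intro η
    have := key η 1
    linarith
  have hval : γ ηStar = (1 - ε) * C / (C - u ⬝ᵥ w) := by
    have h1 : ηStar ⬝ᵥ Ξ.mulVec ηStar = C ^ 2 / (u ⬝ᵥ w) := by
      rw [hηStar, Matrix.mulVec_smul, hΞw, smul_dotProduct, dotProduct_smul,
        dotProduct_comm w u]
      simp only [smul_eq_mul]
      field_simp
    have h2 : u ⬝ᵥ ηStar = C := by
      rw [hηStar, dotProduct_smul, smul_eq_mul]
      field_simp
    have hd := hden ηStar
    rw [hγ]
    rw [h1, h2] at hd ⊢
    rw [div_eq_div_iff hd.ne' (by linarith)]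
    field_simp
    ring
  refine ⟨hden, fun η => ?_, hval⟩
  rw [hval, hγ, div_le_div_iff₀ (hden η) (by linarith)]
  have h := mul_nonneg hs.le (key η (C / (u ⬝ᵥ w)))
  have h' : (u ⬝ᵥ w) * (η ⬝ᵥ Ξ.mulVec η - 2 * (C / (u ⬝ᵥ w)) * (u ⬝ᵥ η)
      + (C / (u ⬝ᵥ w)) ^ 2 * (u ⬝ᵥ w))
      = (u ⬝ᵥ w) * (η ⬝ᵥ Ξ.mulVec η) - 2 * C * (u ⬝ᵥ η) + C ^ 2 := by
    field_simp
  rw [h'] at h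
  have := mul_nonneg (by linarith : (0:ℝ) ≤ 1 - ε) h
  linarith
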